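/- arXiv:2008.02896 — 5 statements merged into one kernel-verified Lean document; each statement's English description precedes it below -/
import Mathlib

section
/- Let A be an M × N integer matrix and K a field. A finite set B ⊆ ker_ℤ A is a Markov basis for A if and only if the set of binomials { x^{b⁺} − x^{b⁻} : b ∈ B } generates the toric ideal I_A of A in K[x_1, …, x_N]. -/
open MvPolynomial

/-- The binomial `x^{b⁺} − x^{b⁻}` associated to an integer vector `b`,
where `b = b⁺ − b⁻` is the unique decomposition into nonnegative vectors
with disjoint supports. -/
noncomputable def vecBinomial {N : ℕ} (K : Type) [Field K] (b : Fin N → ℤ) :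
    MvPolynomial (Fin N) K :=
  (∏ i, X i ^ (b i).toNat) - ∏ i, X i ^ (-b i).toNat

/-- The toric ideal `I_A` of an integer matrix `A`, generated by the binomials
`x^{u⁺} − x^{u⁻}` for `u` in the integer kernel of `A`. -/
noncomputable def toricIdealMatrix {M N : ℕ} (K : Type) [Field K]
    (A : Matrix (Fin M) (Fin N) ℤ) : Ideal (MvPolynomial (Fin N) K) :=
  Ideal.span { f | ∃ u : Fin N → ℤ, A.mulVec u = 0 ∧ f = vecBinomial K u }

/-- `B` is a Markov basis for `A`: any two nonnegative integer vectors in the same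
fiber of `A` are connected by moves from `±B` staying nonnegative throughout. -/
def IsMarkovBasis {M N : ℕ} (A : Matrix (Fin M) (Fin N) ℤ)
    (B : Finset (Fin N → ℤ)) : Prop :=
  ∀ u v : Fin N → ℕ,
    A.mulVec (fun i => (u i : ℤ)) = A.mulVec (fun i => (v i : ℤ)) →
    ∃ (r : ℕ) (b : Fin r → (Fin N → ℤ)),
      (∀ k, b k ∈ B ∨ -b k ∈ B) ∧
      (fun i => (v i : ℤ)) = (fun i => (u i : ℤ)) + ∑ k, b k ∧
      ∀ s : ℕ, s ≤ r → ∀ i : Fin N,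
        0 ≤ (u i : ℤ) + ∑ k ∈ Finset.univ.filter (fun k : Fin r => (k : ℕ) < s), b k i

/-- Two nonnegative vectors differ by a single move from `±B`. -/
def MarkovStep {N : ℕ} (B : Finset (Fin N → ℤ)) (u v : Fin N → ℕ) : Prop :=
  ∃ b : Fin N → ℤ, (b ∈ B ∨ -b ∈ B) ∧ ∀ i, (v i : ℤ) = u i + b i

instance MarkovStep.stdSymm {N : ℕ} (B : Finset (Fin N → ℤ)) : Std.Symm (MarkovStep B) where
  symm _ _ := fun ⟨b, hb, h⟩ =>
    ⟨-b, by rw [neg_neg]; exact hb.symm, fun i => by rw [h i, Pi.neg_apply]; ring⟩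

theorem MarkovStep.add_right {N : ℕ} {B : Finset (Fin N → ℤ)} {u v : Fin N → ℕ}
    (h : MarkovStep B u v) (w : Fin N → ℕ) : MarkovStep B (u + w) (v + w) := by
  obtain ⟨b, hb, h⟩ := h
  exact ⟨b, hb, fun i => by simp only [Pi.add_apply, Nat.cast_add, h i]; ring⟩

theorem MarkovStep.reflTransGen_add_right {N : ℕ} {B : Finset (Fin N → ℤ)} {u v : Fin N → ℕ}
    (h : Relation.ReflTransGen (MarkovStep B) u v) (w : Fin N → ℕ) :
    Relation.ReflTransGen (MarkovStep B) (u + w) (v + w) :=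
  h.lift (· + w) fun _ _ hs => hs.add_right w

/-- Connectivity by moves from `±B`, as an additive congruence. -/
def markovCon {N : ℕ} (B : Finset (Fin N → ℤ)) : AddCon (Fin N → ℕ) where
  r := Relation.ReflTransGen (MarkovStep B)
  iseqv := ⟨fun _ => .refl,
    symm_of (Relation.ReflTransGen (MarkovStep B)),
    fun h₁ h₂ => h₁.trans h₂⟩
  add' {w x y z} h₁ h₂ := by
    refine (MarkovStep.reflTransGen_add_right h₁ y).trans ?_
    rw [add_comm x y, add_comm x z]
    exact MarkovStep.reflTransGen_add_right h₂ x

theorem isMarkovBasis_iff_reflTransGen {M N : ℕ} (A : Matrix (Fin M) (Fin N) ℤ)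
    (B : Finset (Fin N → ℤ)) :
    IsMarkovBasis A B ↔ ∀ u v : Fin N → ℕ,
      A.mulVec (fun i => (u i : ℤ)) = A.mulVec (fun i => (v i : ℤ)) →
      Relation.ReflTransGen (MarkovStep B) u v := by
  refine forall_congr' fun u => forall_congr' fun v => imp_congr_right fun huv => ⟨?_, fun h => ?_⟩
  · rintro ⟨r, b, hb, hv, hpos⟩
    have key : ∀ s ≤ r, ∀ w : Fin N → ℕ,
        (∀ i, (w i : ℤ) = u i +
          ∑ k ∈ Finset.univ.filter (fun k : Fin r => (k : ℕ) < s), b k i) →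
        Relation.ReflTransGen (MarkovStep B) u w := by
      intro s
      induction s with
      | zero =>
        intro _ w hw
        have : w = u := by
          funext i
          simpa using hw i
        rw [this]
      | succ s ih =>
        intro hs w hw
        refine (ih (by omega) (fun i => ((u i : ℤ) +
          ∑ k ∈ Finset.univ.filter (fun k : Fin r => (k : ℕ) < s), b k i).toNat)
          fun i => Int.toNat_of_nonneg (hpos s (by omega) i)).tail ?_
        refine ⟨b ⟨s, hs⟩, hb _, fun i => ?_⟩
        have hfilter : Finset.univ.filter (fun k : Fin r => (k : ℕ) < s + 1) =
            insert ⟨s, hs⟩ (Finset.univ.filter (fun k : Fin r => (k : ℕ) < s)) := by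
          ext k
          simp only [Finset.mem_filter, Finset.mem_univ, true_and, Finset.mem_insert, Fin.ext_iff]
          omega
        rw [Int.toNat_of_nonneg (hpos s (by omega) i), hw i, hfilter,
          Finset.sum_insert (by simp)]
        ring
    refine key r le_rfl v fun i => ?_
    simpa using congrFun hv i
  · clear huv
    induction h with
    | refl => exact ⟨0, Fin.elim0, fun k => k.elim0, by simp, by simp⟩
    | @tail w v _ hs ih =>
      obtain ⟨r, b, hb, hw, hpos⟩ := ih
      obtain ⟨c, hc, hv⟩ := hs
      have hsum : (fun i => (v i : ℤ)) = (fun i => (u i : ℤ))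
          + ∑ k, Fin.snoc (α := fun _ => Fin N → ℤ) b c k := by
        rw [Fin.sum_univ_castSucc]
        simp only [Fin.snoc_castSucc, Fin.snoc_last]
        rw [← add_assoc, ← hw]
        exact funext hv
      refine ⟨r + 1, Fin.snoc (α := fun _ => Fin N → ℤ) b c, ?_, hsum, ?_⟩
      · intro k
        refine Fin.lastCases ?_ (fun k => ?_) k
        · simpa using hc
        · simpa using hb k
      · intro s hs i
        rcases Nat.lt_or_ge r s with h | h
        · have := congrFun hsum i
          rw [Pi.add_apply, Finset.sum_apply] at this
          rw [Finset.filter_true_of_mem (fun k _ => by omega), ← this]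
          positivity
        · have := hpos s h i
          rw [Finset.sum_filter] at this ⊢
          rw [Fin.sum_univ_castSucc]
          simpa [Nat.not_lt.mpr h] using this

/-- The monomial `x^u`. -/
noncomputable def vecMonomial {N : ℕ} (K : Type) [Field K] (u : Fin N → ℕ) :
    MvPolynomial (Fin N) K :=
  ∏ i, X i ^ u i

theorem vecMonomial_add {N : ℕ} (K : Type) [Field K] (u v : Fin N → ℕ) :
    vecMonomial K (u + v) = vecMonomial K u * vecMonomial K v := by
  simp only [vecMonomial, Pi.add_apply, pow_add, Finset.prod_mul_distrib]

theorem vecBinomial_eq_sub {N : ℕ} (K : Type) [Field K] (b : Fin N → ℤ) :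
    vecBinomial K b =
      vecMonomial K (fun i => (b i).toNat) - vecMonomial K (fun i => (-b i).toNat) :=
  rfl

theorem vecMonomial_sub_eq_mul_vecBinomial {N : ℕ} (K : Type) [Field K] {u v : Fin N → ℕ}
    {b : Fin N → ℤ} (h : ∀ i, (v i : ℤ) = u i + b i) :
    vecMonomial K v - vecMonomial K u =
      vecMonomial K (fun i => min (u i) (v i)) * vecBinomial K b := by
  rw [vecBinomial_eq_sub, mul_sub, ← vecMonomial_add, ← vecMonomial_add]
  congr 2 <;>
  · funext i
    have := h i
    simp only [Pi.add_apply]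
    omega

theorem vecBinomial_neg {N : ℕ} (K : Type) [Field K] (b : Fin N → ℤ) :
    vecBinomial K (-b) = -vecBinomial K b := by
  simp [vecBinomial]

theorem vecMonomial_sub_mem_of_reflTransGen {N : ℕ} (K : Type) [Field K]
    {B : Finset (Fin N → ℤ)} {u v : Fin N → ℕ}
    (h : Relation.ReflTransGen (MarkovStep B) u v) :
    vecMonomial K v - vecMonomial K u ∈
      Ideal.span ((fun b => vecBinomial K b) '' (B : Set (Fin N → ℤ))) := by
  induction h with
  | refl => simp
  | @tail w v _ hs ih =>
    rw [← sub_add_sub_cancel _ (vecMonomial K w)]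
    refine add_mem ?_ ih
    obtain ⟨b, hb, h⟩ := hs
    rw [vecMonomial_sub_eq_mul_vecBinomial K h]
    refine Ideal.mul_mem_left _ _ ?_
    rcases hb with hb | hb
    · exact Ideal.subset_span ⟨b, hb, rfl⟩
    · rw [← neg_mem_iff, ← vecBinomial_neg]
      exact Ideal.subset_span ⟨-b, hb, rfl⟩

/-- The map sending `x^u` to the connectivity class of `u`. -/
noncomputable def markovClassHom {N : ℕ} (K : Type) [Field K] (B : Finset (Fin N → ℤ)) :
    MvPolynomial (Fin N) K →ₐ[K] AddMonoidAlgebra K (markovCon B).Quotient :=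
  aeval fun i => AddMonoidAlgebra.single ((markovCon B).mk' (Pi.single i 1)) 1

theorem markovClassHom_vecMonomial {N : ℕ} (K : Type) [Field K] (B : Finset (Fin N → ℤ))
    (u : Fin N → ℕ) :
    markovClassHom K B (vecMonomial K u) =
      AddMonoidAlgebra.single ((markovCon B).mk' u) 1 := by
  have hsum : u = ∑ i, u i • (Pi.single i 1 : Fin N → ℕ) := by
    simp only [← Pi.single_smul', smul_eq_mul, mul_one, Finset.univ_sum_single]
  conv_rhs => rw [hsum, map_sum]
  have hof := map_prod (AddMonoidAlgebra.of K (markovCon B).Quotient)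
    (fun i => Multiplicative.ofAdd ((markovCon B).mk' (u i • Pi.single i 1))) Finset.univ
  rw [← ofAdd_sum] at hof
  refine Eq.trans ?_ hof.symm
  simp only [vecMonomial, markovClassHom, map_prod, map_pow, aeval_X, map_nsmul, ofAdd_nsmul]
  rfl

theorem reflTransGen_of_vecMonomial_sub_mem {N : ℕ} (K : Type) [Field K]
    {B : Finset (Fin N → ℤ)} {u v : Fin N → ℕ}
    (h : vecMonomial K v - vecMonomial K u ∈
      Ideal.span ((fun b => vecBinomial K b) '' (B : Set (Fin N → ℤ)))) :
    Relation.ReflTransGen (MarkovStep B) u v := by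
  have hle : Ideal.span ((fun b => vecBinomial K b) '' (B : Set (Fin N → ℤ))) ≤
      RingHom.ker (markovClassHom K B) := by
    rw [Ideal.span_le]
    rintro _ ⟨b, hb, rfl⟩
    simp only [SetLike.mem_coe, RingHom.mem_ker]
    rw [vecBinomial_eq_sub, map_sub, markovClassHom_vecMonomial, markovClassHom_vecMonomial,
      sub_eq_zero]
    congr 1
    refine ((markovCon B).eq.2 (Relation.ReflTransGen.single ⟨b, Or.inl hb, fun i => ?_⟩)).symm
    omega
  have hker := hle h
  rw [RingHom.mem_ker, map_sub, markovClassHom_vecMonomial, markovClassHom_vecMonomial,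
    sub_eq_zero] at hker
  exact (markovCon B).eq.1 (AddMonoidAlgebra.single_left_injective (one_ne_zero (α := K)) hker.symm)

/-- Fundamental theorem of Markov bases: a finite set `B ⊆ kerℤ A` is a Markov
basis for `A` if and only if the binomials `x^{b⁺} − x^{b⁻}`, `b ∈ B`, generate
the toric ideal `I_A`. -/
theorem stmt0 {M N : ℕ} (K : Type) [Field K] (A : Matrix (Fin M) (Fin N) ℤ)
    (B : Finset (Fin N → ℤ)) (hB : ∀ b ∈ B, A.mulVec b = 0) :
    IsMarkovBasis A B ↔
      Ideal.span ((fun b => vecBinomial K b) '' (B : Set (Fin N → ℤ)))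
        = toricIdealMatrix K A := by
  rw [isMarkovBasis_iff_reflTransGen]
  constructor
  · intro h
    refine le_antisymm (Ideal.span_mono ?_) (Ideal.span_le.2 ?_)
    · rintro _ ⟨b, hb, rfl⟩
      exact ⟨b, hB b hb, rfl⟩
    · rintro _ ⟨w, hw, rfl⟩
      rw [vecBinomial_eq_sub]
      refine vecMonomial_sub_mem_of_reflTransGen K (h _ _ ?_)
      rw [eq_comm, ← sub_eq_zero, ← Matrix.mulVec_sub, ← hw]
      congr 1
      funext i
      simp only [Pi.sub_apply]
      omega
  · intro h u v huv
    refine reflTransGen_of_vecMonomial_sub_mem K ?_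
    rw [h, vecMonomial_sub_eq_mul_vecBinomial K
      (b := (fun i => (v i : ℤ)) - fun i => (u i : ℤ)) (fun i => by simp)]
    refine Ideal.mul_mem_left _ _ (Ideal.subset_span ⟨_, ?_, rfl⟩)
    rw [Matrix.mulVec_sub, huv, sub_self]
end

section
/- If G is a finite simple bipartite graph and K is a field, then the toric ideal I_G is generated by the binomials B_w arising from the even cycles w of G. -/
open MvPolynomial

/-- The ring homomorphism `φ_G : K[E] → K[V]`, sending `y_{uv} ↦ x_u x_v`. -/
noncomputable def phiG {V : Type} (K : Type) [Field K] (G : SimpleGraph V) :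
    MvPolynomial G.edgeSet K →ₐ[K] MvPolynomial V K :=
  aeval fun e => Sym2.lift ⟨fun u w => X u * X w, fun u w => mul_comm _ _⟩ (e : Sym2 V)

/-- The toric ideal of a graph, `I_G = ker φ_G`. -/
noncomputable def toricIdealGraph {V : Type} (K : Type) [Field K] (G : SimpleGraph V) :
    Ideal (MvPolynomial G.edgeSet K) :=
  RingHom.ker (phiG K G).toRingHom

/-- The binomial `B_w = ∏ y_{e_{2i-1}} − ∏ y_{e_{2i}}` arising from an even closed
sequence of `2n` vertices, consecutive ones adjacent. -/
noncomputable def cycleBinomial {V : Type} (K : Type) [Field K] (G : SimpleGraph V)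
    (n : ℕ) (v : ZMod (2 * n) → V) (h : ∀ i, G.Adj (v i) (v (i + 1))) :
    MvPolynomial G.edgeSet K :=
  (∏ i : Fin n,
      X (⟨s(v ((2 * (i : ℕ) : ℕ) : ZMod (2 * n)), v ((2 * (i : ℕ) : ℕ) + 1)),
        G.mem_edgeSet.mpr (h ((2 * (i : ℕ) : ℕ) : ZMod (2 * n)))⟩ : G.edgeSet))
  - ∏ i : Fin n,
      X (⟨s(v (((2 * (i : ℕ) : ℕ) : ZMod (2 * n)) + 1), v (((2 * (i : ℕ) : ℕ) : ZMod (2 * n)) + 1 + 1)),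
        G.mem_edgeSet.mpr (h (((2 * (i : ℕ) : ℕ) : ZMod (2 * n)) + 1))⟩ : G.edgeSet)

/-- The set of binomials arising from the even cycles of `G`: an even cycle is an
injective cyclic sequence of `2n ≥ 4` vertices with consecutive vertices adjacent. -/
noncomputable def evenCycleBinomials {V : Type} (K : Type) [Field K] (G : SimpleGraph V) :
    Set (MvPolynomial G.edgeSet K) :=
  { f | ∃ (n : ℕ), 2 ≤ n ∧ ∃ (v : ZMod (2 * n) → V) (_ : Function.Injective v)
        (h : ∀ i, G.Adj (v i) (v (i + 1))), f = cycleBinomial K G n v h }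

namespace SimpleGraph

variable {V : Type} {K : Type} [Field K] {G : SimpleGraph V}

/-- The exponent of the monomial `φ_G(y_e)`: the sum of the indicators of the ends of `e`. -/
noncomputable def edgeExponent (e : G.edgeSet) : V →₀ ℕ :=
  Sym2.lift ⟨fun u w => Finsupp.single u 1 + Finsupp.single w 1, fun _ _ => add_comm _ _⟩
    (e : Sym2 V)

/-- The degree map on exponents: `φ_G(y^a) = x^(toricDegree a)`. -/
noncomputable def toricDegree : (G.edgeSet →₀ ℕ) →ₗ[ℕ] (V →₀ ℕ) :=
  Finsupp.linearCombination ℕ edgeExponent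

lemma edgeExponent_ne_zero_iff (e : G.edgeSet) (v : V) :
    edgeExponent e v ≠ 0 ↔ v ∈ (e : Sym2 V) := by
  classical
  obtain ⟨e, he⟩ := e
  induction e with
  | _ u w =>
    simp only [edgeExponent, Sym2.lift_mk, Finsupp.add_apply, Finsupp.single_apply, Sym2.mem_iff]
    grind

lemma toricDegree_ne_zero_iff (a : G.edgeSet →₀ ℕ) (v : V) :
    toricDegree a v ≠ 0 ↔ ∃ e ∈ a.support, v ∈ (e : Sym2 V) := by
  simp only [toricDegree, Finsupp.linearCombination_apply, Finsupp.sum, Finsupp.finsetSum_apply,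
    ne_eq, Finset.sum_eq_zero_iff, not_forall, Finsupp.smul_apply, smul_eq_mul, mul_eq_zero,
    not_or, ← edgeExponent_ne_zero_iff, Finsupp.mem_support_iff]
  grind

lemma toricDegree_eq_zero_iff {a : G.edgeSet →₀ ℕ} : toricDegree a = 0 ↔ a = 0 := by
  refine ⟨fun h => ?_, fun h => by simp [h]⟩
  by_contra ha
  obtain ⟨e, he⟩ := Finsupp.support_nonempty_iff.mpr ha
  exact (toricDegree_ne_zero_iff a (e : Sym2 V).out.1).mpr ⟨e, he, Sym2.out_fst_mem _⟩
    (by simp [h])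

lemma phiG_X (e : G.edgeSet) : phiG K G (X e) = monomial (edgeExponent e) 1 := by
  obtain ⟨e, he⟩ := e
  induction e with
  | _ u w =>
    rw [phiG, aeval_X]
    simp [edgeExponent, X, monomial_mul]

lemma phiG_monomial (a : G.edgeSet →₀ ℕ) :
    phiG K G (monomial a 1) = monomial (toricDegree a) 1 := by
  rw [toricDegree, Finsupp.linearCombination_apply, monomial_finsupp_sum_index, monomial_eq, C_1,
    one_mul, map_finsuppProd]
  simp only [map_pow, phiG_X, monomial_pow, one_pow, C_1, one_mul]

lemma mem_toricIdealGraph {f : MvPolynomial G.edgeSet K} :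
    f ∈ toricIdealGraph K G ↔ phiG K G f = 0 := Iff.rfl

lemma monomial_sub_mem_toricIdealGraph {a b : G.edgeSet →₀ ℕ} :
    monomial a 1 - monomial b 1 ∈ toricIdealGraph K G ↔ toricDegree a = toricDegree b := by
  rw [mem_toricIdealGraph, map_sub, phiG_monomial, phiG_monomial, sub_eq_zero]
  exact (monomial_left_injective one_ne_zero).eq_iff

/-- The toric ideal lies in every ideal containing its pure binomials. -/
lemma toricIdealGraph_le {J : Ideal (MvPolynomial G.edgeSet K)}
    (hJ : ∀ a b : G.edgeSet →₀ ℕ, toricDegree a = toricDegree b →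
      monomial a 1 - monomial b 1 ∈ J) :
    toricIdealGraph K G ≤ J := by
  let T : MvPolynomial V K →ₗ[K] MvPolynomial G.edgeSet K ⧸ J :=
    (basisMonomials V K).constr K
      fun m => Ideal.Quotient.mk J (monomial (Function.invFun toricDegree m) 1)
  have hT : T ∘ₗ (phiG K G).toLinearMap = (Ideal.Quotient.mkₐ K J).toLinearMap := by
    refine (basisMonomials G.edgeSet K).ext fun a => ?_
    have h1 : T (monomial (toricDegree a) 1) =
        Ideal.Quotient.mk J (monomial (Function.invFun toricDegree (toricDegree a)) 1) := by
      simpa only [coe_basisMonomials] using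
        (basisMonomials V K).constr_basis K
          (fun m => Ideal.Quotient.mk J (monomial (Function.invFun toricDegree m) 1))
          (toricDegree a)
    simp only [coe_basisMonomials, LinearMap.comp_apply, AlgHom.toLinearMap_apply, phiG_monomial,
      h1, Ideal.Quotient.mkₐ_eq_mk]
    exact Ideal.Quotient.eq.mpr (hJ _ _ (Function.invFun_eq ⟨a, rfl⟩))
  intro f hf
  have := LinearMap.congr_fun hT f
  rw [LinearMap.comp_apply, AlgHom.toLinearMap_apply, mem_toricIdealGraph.mp hf, map_zero] at this
  exact Ideal.Quotient.eq_zero_iff_mem.mp this.symm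

/-- The edge from `v i` to `v (i + 1)` of a cyclic sequence of vertices. -/
def cycleEdge {m : ℕ} (v : ZMod m → V) (h : ∀ i, G.Adj (v i) (v (i + 1))) (i : ZMod m) :
    G.edgeSet :=
  ⟨s(v i, v (i + 1)), G.mem_edgeSet.mpr (h i)⟩

lemma cycleBinomial_eq (n : ℕ) (v : ZMod (2 * n) → V) (h : ∀ i, G.Adj (v i) (v (i + 1))) :
    cycleBinomial K G n v h =
      monomial (∑ i : Fin n, Finsupp.single (cycleEdge v h ((2 * (i : ℕ) : ℕ))) 1) 1 -
      monomial (∑ i : Fin n, Finsupp.single (cycleEdge v h ((2 * (i : ℕ) : ℕ) + 1)) 1) 1 := by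
  rw [monomial_sum_one, monomial_sum_one]
  rfl

lemma cycleBinomial_mem_toricIdealGraph (n : ℕ) (v : ZMod (2 * n) → V)
    (h : ∀ i, G.Adj (v i) (v (i + 1))) : cycleBinomial K G n v h ∈ toricIdealGraph K G := by
  rw [mem_toricIdealGraph, cycleBinomial, map_sub, map_prod, map_prod, sub_eq_zero]
  simp only [phiG, aeval_X, Sym2.lift_mk, Finset.prod_mul_distrib]
  rw [mul_comm]
  congr 1
  have key (g : ZMod (2 * n) → MvPolynomial V K) :
      ∏ i : Fin n, g ((2 * (i : ℕ) : ℕ)) = ∏ i : Fin n, g ((2 * (i : ℕ) : ℕ) + 1 + 1) := by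
    rw [Fin.prod_univ_eq_prod_range (fun i => g ((2 * i : ℕ))),
      Fin.prod_univ_eq_prod_range (fun i => g ((2 * i : ℕ) + 1 + 1))]
    cases n with
    | zero => simp
    | succ m =>
      rw [Finset.prod_range_succ', Finset.prod_range_succ]
      have h0 : (((2 * m : ℕ) : ZMod (2 * (m + 1))) + 1 + 1) = 0 := by
        have := ZMod.natCast_self (2 * (m + 1))
        rw [← this]; push_cast; ring
      rw [h0, mul_zero, Nat.cast_zero]
      congr 1
      refine Finset.prod_congr rfl fun i _ => ?_
      congr 1; push_cast; ring
  exact key fun i => X (v i)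

lemma sum_single_le {ι α : Type*} [Fintype ι] {e : ι → α} (he : Function.Injective e)
    {a : α →₀ ℕ} (ha : ∀ i, e i ∈ a.support) : ∑ i, Finsupp.single (e i) 1 ≤ a := by
  classical
  intro x
  rw [Finsupp.finsetSum_apply]
  by_cases hx : ∃ i, e i = x
  · obtain ⟨i, rfl⟩ := hx
    rw [Finset.sum_eq_single i (fun j _ hj => Finsupp.single_eq_of_ne (he.ne hj.symm)) (by simp)]
    simpa [Nat.one_le_iff_ne_zero] using ha i
  · rw [Finset.sum_eq_zero fun i _ => Finsupp.single_eq_of_ne fun h => hx ⟨i, h.symm⟩]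
    exact zero_le

lemma exists_mem_periodicPts {α : Type*} [Finite α] [Nonempty α] (f : α → α) :
    ∃ x, x ∈ Function.periodicPts f := by
  obtain ⟨y⟩ := ‹Nonempty α›
  obtain ⟨m, n, hne, heq⟩ := Finite.exists_ne_map_eq_of_infinite fun k => f^[k] y
  wlog hlt : m < n generalizing m n
  · exact this n m hne.symm heq.symm (by omega)
  refine ⟨f^[m] y, n - m, by omega, ?_⟩
  rw [Function.IsPeriodicPt, Function.IsFixedPt, ← Function.iterate_add_apply,
    Nat.sub_add_cancel hlt.le]
  exact heq.symm

lemma exists_alternating_cycle [Finite V] (C : G.Coloring (Fin 2)) {a b : G.edgeSet →₀ ℕ}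
    (hab : toricDegree a = toricDegree b) (hb : b ≠ 0) (hdisj : Disjoint a.support b.support) :
    ∃ n, 2 ≤ n ∧ ∃ v : ZMod (2 * n) → V, Function.Injective v ∧
      ∃ h : ∀ i, G.Adj (v i) (v (i + 1)), (∀ k : ℕ, C (v (2 * k : ℕ)) = 0) ∧
        (∀ k : ℕ, cycleEdge v h (2 * k : ℕ) ∈ a.support) ∧
        (∀ k : ℕ, cycleEdge v h ((2 * k : ℕ) + 1) ∈ b.support) := by
  have other {c : G.edgeSet →₀ ℕ} {u : V} (hu : toricDegree c u ≠ 0) :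
      ∃ w, ∃ h : G.Adj u w, toricDegree c w ≠ 0 ∧
        (⟨s(u, w), G.mem_edgeSet.mpr h⟩ : G.edgeSet) ∈ c.support := by
    obtain ⟨⟨e, he⟩, hec, hue⟩ := (toricDegree_ne_zero_iff c u).mp hu
    obtain ⟨w, rfl⟩ := Sym2.mem_iff_exists.mp hue
    exact ⟨w, G.mem_edgeSet.mp he, (toricDegree_ne_zero_iff c w).mpr
      ⟨_, hec, Sym2.mem_mk_right u w⟩, hec⟩
  have step (u : {u : V // toricDegree b u ≠ 0}) :
      ∃ w : {w : V // toricDegree b w ≠ 0}, ∃ h : G.Adj u w,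
        (C u = 0 → (⟨s(↑u, ↑w), G.mem_edgeSet.mpr h⟩ : G.edgeSet) ∈ a.support) ∧
        (C u ≠ 0 → (⟨s(↑u, ↑w), G.mem_edgeSet.mpr h⟩ : G.edgeSet) ∈ b.support) := by
    by_cases hC : C u = 0
    · obtain ⟨w, h, hw, hmem⟩ := other (c := a) (u := u) (by rw [hab]; exact u.2)
      rw [hab] at hw
      exact ⟨⟨w, hw⟩, h, fun _ => hmem, fun h => absurd hC h⟩
    · obtain ⟨w, h, hw, hmem⟩ := other u.2
      exact ⟨⟨w, hw⟩, h, fun h => absurd h hC, fun _ => hmem⟩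
  choose f hadj hfa hfb using step
  have hne : Nonempty {u : V // toricDegree b u ≠ 0} := by
    by_contra hcon
    rw [not_nonempty_iff, isEmpty_subtype] at hcon
    exact hb (toricDegree_eq_zero_iff.mp (Finsupp.ext fun u => not_not.mp (hcon u)))
  obtain ⟨x, hx, hCx⟩ : ∃ x, x ∈ Function.periodicPts f ∧ C x = 0 := by
    obtain ⟨x, hx⟩ := exists_mem_periodicPts f
    by_cases hC : C x = 0
    · exact ⟨x, hx, hC⟩
    · refine ⟨f x, ?_, ?_⟩
      · obtain ⟨k, hk, hk'⟩ := hx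
        exact ⟨k, hk, hk'.map (Function.Commute.refl f)⟩
      · have := C.valid (hadj x)
        omega
  have hcol (k : ℕ) : C (f^[k] x) = 0 ↔ Even k := by
    induction k with
    | zero => simpa using hCx
    | succ k ih =>
      rw [Function.iterate_succ_apply', Nat.even_add_one, ← ih]
      have := C.valid (hadj (f^[k] x))
      omega
  have hpos := Function.minimalPeriod_pos_of_mem_periodicPts hx
  have heven : Even (Function.minimalPeriod f x) := by
    rw [← hcol, Function.iterate_minimalPeriod]
    exact hCx
  obtain ⟨n, hn⟩ := heven.exists_two_nsmul
  rw [smul_eq_mul] at hn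
  have hn2 : 2 ≤ n := by
    by_contra hlt
    obtain rfl : n = 1 := by omega
    have hff : f (f x) = x := by
      have := Function.iterate_minimalPeriod (f := f) (x := x)
      rwa [hn] at this
    have h1 := hfa x hCx
    have h2 := hfb (f x) (by have := C.valid (hadj x); omega)
    simp only [hff, Sym2.eq_swap (a := (f x : V))] at h2
    exact Finset.disjoint_left.mp hdisj h1 h2
  have : NeZero (2 * n) := ⟨by omega⟩
  let v : ZMod (2 * n) → V := fun i => f^[i.val] x
  have hv (k : ℕ) : v k = f^[k] x := by
    simp only [v, ZMod.val_natCast]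
    rw [← hn, Function.iterate_mod_minimalPeriod_eq]
  have hsucc (k : ℕ) : v (k + 1) = f (f^[k] x) := by
    rw [← Function.iterate_succ_apply' f, ← hv, Nat.cast_succ]
  have hvadj (i : ZMod (2 * n)) : G.Adj (v i) (v (i + 1)) := by
    rw [← ZMod.natCast_zmod_val i, hv, hsucc]
    exact hadj _
  refine ⟨n, hn2, v, ?_, hvadj, fun k => ?_, fun k => ?_, fun k => ?_⟩
  · intro i j hij
    refine ZMod.val_injective _ (Function.iterate_injOn_Iio_minimalPeriod (f := f) (x := x) ?_ ?_
      (Subtype.ext hij))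
    · simpa [hn] using ZMod.val_lt i
    · simpa [hn] using ZMod.val_lt j
  · rw [hv, hcol]
    exact even_two_mul k
  · have := hfa _ ((hcol (2 * k)).mpr (even_two_mul k))
    simp only [cycleEdge, hsucc, hv]
    exact this
  · have := hfb (f^[2 * k + 1] x) (by rw [ne_eq, hcol]; simp)
    simpa only [cycleEdge, ← Nat.cast_succ, hv, Function.iterate_succ_apply'] using this

lemma monomial_sub_mem_span_evenCycleBinomials [Finite V] (hbip : G.Colorable 2)
    (a b : G.edgeSet →₀ ℕ) (hab : toricDegree a = toricDegree b) :
    monomial a 1 - monomial b 1 ∈ Ideal.span (evenCycleBinomials K G) := by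
  obtain ⟨C⟩ := hbip
  induction hN : b.degree using Nat.strong_induction_on generalizing a b with
  | _ N ih =>
  have common {c : G.edgeSet →₀ ℕ} (hcb : toricDegree c = toricDegree b) {e : G.edgeSet}
      (hec : e ∈ c.support) (heb : e ∈ b.support) :
      monomial c 1 - monomial b 1 ∈ Ideal.span (evenCycleBinomials K G) := by
    obtain ⟨c, rfl⟩ := exists_add_of_le (Finsupp.single_le_iff.mpr
      (Nat.one_le_iff_ne_zero.mpr (Finsupp.mem_support_iff.mp hec)))
    obtain ⟨b, rfl⟩ := exists_add_of_le (Finsupp.single_le_iff.mpr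
      (Nat.one_le_iff_ne_zero.mpr (Finsupp.mem_support_iff.mp heb)))
    rw [map_add, map_add, add_right_inj] at hcb
    have := ih b.degree (by rw [← hN, map_add, Finsupp.degree_single]; omega) c b hcb rfl
    rw [← one_mul (1 : K), ← monomial_mul, ← monomial_mul, ← mul_sub]
    exact Ideal.mul_mem_left _ _ this
  by_cases hb : b = 0
  · subst hb
    rw [map_zero, toricDegree_eq_zero_iff] at hab
    simp [hab]
  by_cases hdisj : Disjoint a.support b.support
  · obtain ⟨n, hn, v, hinj, h, hcol, ha', hb'⟩ := exists_alternating_cycle C hab hb hdisj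
    have hle : ∑ i : Fin n, Finsupp.single (cycleEdge v h ((2 * (i : ℕ) : ℕ))) 1 ≤ a := by
      refine sum_single_le (fun i j hij => ?_) fun i => ha' i
      have hC := C.valid (h (2 * (j : ℕ) : ℕ))
      rcases Sym2.eq_iff.mp (Subtype.ext_iff.mp hij) with ⟨hij, -⟩ | ⟨hij, -⟩
      · have := (ZMod.natCast_eq_natCast_iff' _ _ _).mp (hinj hij)
        rw [Nat.mod_eq_of_lt (by omega), Nat.mod_eq_of_lt (by omega)] at this
        omega
      · rw [← hij, hcol, hcol] at hC
        exact absurd rfl hC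
    have hmem : cycleBinomial K G n v h ∈ Ideal.span (evenCycleBinomials K G) :=
      Ideal.subset_span ⟨n, hn, v, hinj, h, rfl⟩
    have hdeg := cycleBinomial_mem_toricIdealGraph (K := K) n v h
    rw [cycleBinomial_eq] at hmem hdeg
    rw [monomial_sub_mem_toricIdealGraph] at hdeg
    obtain ⟨c, rfl⟩ := exists_add_of_le hle
    rw [map_add, hdeg, ← map_add] at hab
    have hlast := common hab (e := cycleEdge v h ((2 * 0 : ℕ) + 1)) (by
      rw [Finsupp.mem_support_iff, Finsupp.add_apply, Finsupp.finsetSum_apply]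
      refine ne_of_gt (Nat.add_pos_left (Finset.sum_pos' (fun _ _ => zero_le)
        ⟨⟨0, by omega⟩, Finset.mem_univ _, ?_⟩) _)
      simp) (hb' 0)
    have hfirst := Ideal.mul_mem_right (monomial c 1) _ hmem
    rw [sub_mul, monomial_mul, monomial_mul, one_mul] at hfirst
    simpa using add_mem hfirst hlast
  · obtain ⟨e, hea, heb⟩ := Finset.not_disjoint_iff.mp hdisj
    exact common hab hea heb

end SimpleGraph

/-- For a bipartite graph `G`, the toric ideal `I_G` is generated by the binomials
arising from the even cycles of `G`. -/
theorem stmt4 {V : Type} [Fintype V] [DecidableEq V] (K : Type) [Field K]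
    (G : SimpleGraph V) (hbip : G.Colorable 2) :
    Ideal.span (evenCycleBinomials K G) = toricIdealGraph K G := by
  refine le_antisymm (Ideal.span_le.mpr ?_)
    (SimpleGraph.toricIdealGraph_le (SimpleGraph.monomial_sub_mem_span_evenCycleBinomials hbip))
  rintro _ ⟨n, -, v, -, h, rfl⟩
  exact SimpleGraph.cycleBinomial_mem_toricIdealGraph n v h
end

section
/- If G is a finite simple bipartite graph and K is a field, then the toric ideal I_G is generated by the binomials B_w arising from the chordless cycles w of G. -/
open MvPolynomial

/-- The set of binomials arising from the chordless even cycles of `G`: an even cycle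
is an injective cyclic sequence of `2n ≥ 4` vertices with consecutive vertices
adjacent; it is chordless if the only adjacencies among its vertices are the
consecutive ones. -/
noncomputable def chordlessCycleBinomials {V : Type} (K : Type) [Field K]
    (G : SimpleGraph V) : Set (MvPolynomial G.edgeSet K) :=
  { f | ∃ (n : ℕ), 2 ≤ n ∧ ∃ (v : ZMod (2 * n) → V) (_ : Function.Injective v)
        (h : ∀ i, G.Adj (v i) (v (i + 1))),
        (∀ i j : ZMod (2 * n), G.Adj (v i) (v j) → j = i + 1 ∨ i = j + 1) ∧
        f = cycleBinomial K G n v h }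

/-- The exponent vector of the image of the variable `y_e` under `phiG`. -/
noncomputable def edgeEnds {V : Type} (G : SimpleGraph V) (e : G.edgeSet) : V →₀ ℕ :=
  Sym2.lift ⟨fun u w => Finsupp.single u 1 + Finsupp.single w 1, fun _ _ => add_comm _ _⟩
    (e : Sym2 V)

/-- The degree vector of a multiset of edges. -/
noncomputable def edgeDeg {V : Type} (G : SimpleGraph V) :
    (G.edgeSet →₀ ℕ) →ₗ[ℕ] (V →₀ ℕ) :=
  Finsupp.linearCombination ℕ (edgeEnds G)

section Auxiliary

variable {V : Type} {K : Type} [Field K] {G : SimpleGraph V}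

lemma edgeEnds_mk {u w : V} (h : s(u, w) ∈ G.edgeSet) :
    edgeEnds G ⟨s(u, w), h⟩ = Finsupp.single u 1 + Finsupp.single w 1 := rfl

lemma edgeDeg_single (e : G.edgeSet) : edgeDeg G (Finsupp.single e 1) = edgeEnds G e := by
  simp [edgeDeg]

lemma phiG_X_mk {u w : V} (h : s(u, w) ∈ G.edgeSet) :
    phiG K G (X ⟨s(u, w), h⟩) = X u * X w := by
  simp [phiG]

lemma phiG_X (e : G.edgeSet) : phiG K G (X e) = monomial (edgeEnds G e) 1 := by
  obtain ⟨e, he⟩ := e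
  induction e with
  | _ u w => rw [phiG_X_mk, edgeEnds_mk]; simp [X, monomial_mul]

lemma phiG_monomial (a : G.edgeSet →₀ ℕ) :
    phiG K G (monomial a 1) = monomial (edgeDeg G a) 1 := by
  induction a using Finsupp.induction_linear with
  | zero => simp
  | add f g hf hg =>
    have h : (monomial (f + g) (1 : K)) = monomial f 1 * monomial g 1 := by simp [monomial_mul]
    rw [h, map_mul, hf, hg]
    simp [monomial_mul]
  | single e k =>
    rw [← X_pow_eq_monomial, map_pow, phiG_X, monomial_pow,
      show Finsupp.single e k = k • Finsupp.single e 1 by simp, map_nsmul, edgeDeg_single]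
    simp

lemma degree_edgeDeg (a : G.edgeSet →₀ ℕ) : (edgeDeg G a).degree = 2 * a.degree := by
  induction a using Finsupp.induction_linear with
  | zero => simp
  | add f g hf hg => simp [hf, hg, mul_add]
  | single e k =>
    rw [show Finsupp.single e k = k • Finsupp.single e 1 by simp, map_nsmul, edgeDeg_single]
    obtain ⟨e, he⟩ := e
    induction e with
    | _ u w => rw [edgeEnds_mk]; simp [Finsupp.degree_single]; ring

lemma degree_eq_of_edgeDeg_eq {a b : G.edgeSet →₀ ℕ} (h : edgeDeg G a = edgeDeg G b) :
    a.degree = b.degree := by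
  have := degree_edgeDeg a
  rw [h, degree_edgeDeg] at this
  omega

lemma edgeDeg_ne_zero {a : G.edgeSet →₀ ℕ} {u w : V} (h : G.Adj u w)
    (ha : a ⟨s(u, w), h⟩ ≠ 0) : edgeDeg G a u ≠ 0 := by
  obtain ⟨a', rfl⟩ := exists_add_of_le
    (Finsupp.single_le_iff.mpr (Nat.one_le_iff_ne_zero.mpr ha))
  rw [map_add, edgeDeg_single]
  simp [edgeEnds_mk (G.mem_edgeSet.mpr h)]

lemma exists_adj_of_edgeDeg_ne_zero {a : G.edgeSet →₀ ℕ} {u : V} (ha : edgeDeg G a u ≠ 0) :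
    ∃ (w : V) (h : G.Adj u w), a ⟨s(u, w), h⟩ ≠ 0 := by
  rw [edgeDeg, Finsupp.linearCombination_apply, Finsupp.sum, Finsupp.finsetSum_apply] at ha
  obtain ⟨⟨e, he⟩, hs, hne⟩ := Finset.exists_ne_zero_of_sum_ne_zero ha
  have hu : u ∈ e := by
    induction e with
    | _ x y =>
      by_contra hu
      simp only [Sym2.mem_iff, not_or] at hu
      rw [edgeEnds_mk] at hne
      simp [Ne.symm hu.1, Ne.symm hu.2] at hne
  obtain ⟨w, rfl⟩ := hu
  exact ⟨w, he, Finsupp.mem_support_iff.mp hs⟩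

/-- Adding `f (2n)` to a sum over the even-odd pairs of the path `0, …, 2n` is the same as adding
`f 0` to the sum over its odd-even pairs. -/
@[to_additive]
lemma prod_even_pairs_mul {M : Type*} [CommMonoid M] (f : ℕ → M) (n : ℕ) :
    (∏ i ∈ Finset.range n, (f (2 * i) * f (2 * i + 1))) * f (2 * n)
      = f 0 * ∏ i ∈ Finset.range n, (f (2 * i + 1) * f (2 * i + 1 + 1)) := by
  induction n with
  | zero => simp
  | succ n ih =>
    rw [Finset.prod_range_succ, Finset.prod_range_succ, ← mul_assoc (f 0), ← ih, mul_add_one]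
    simp only [mul_assoc]

lemma cycleBinomial_mem (n : ℕ) (v : ZMod (2 * n) → V)
    (h : ∀ i, G.Adj (v i) (v (i + 1))) : cycleBinomial K G n v h ∈ toricIdealGraph K G := by
  change phiG K G (cycleBinomial K G n v h) = 0
  have key := prod_even_pairs_mul (fun i : ℕ => (X (v (i : ZMod (2 * n))) : MvPolynomial V K)) n
  rw [cycleBinomial, map_sub, map_prod, map_prod, sub_eq_zero]
  simp only [phiG_X_mk]
  rw [Finset.prod_range, Finset.prod_range, mul_comm, ZMod.natCast_self, Nat.cast_zero] at key
  have key := mul_left_cancel₀ (X_ne_zero _) key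
  simpa only [Nat.cast_add, Nat.cast_one] using key

lemma sum_single_le {ι α : Type*} (T : Finset ι) (f : ι → α) (hf : Set.InjOn f T)
    (a : α →₀ ℕ) (ha : ∀ i ∈ T, a (f i) ≠ 0) : ∑ i ∈ T, Finsupp.single (f i) 1 ≤ a := by
  classical
  induction T using Finset.induction_on generalizing a with
  | empty => simp
  | insert i T hi ih =>
    rw [Finset.sum_insert hi]
    obtain ⟨a', rfl⟩ := exists_add_of_le (Finsupp.single_le_iff.mpr
      (Nat.one_le_iff_ne_zero.mpr (ha i (Finset.mem_insert_self i T))))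
    refine add_le_add_right (ih (hf.mono (by simp)) a' fun j hj => ?_) _
    have hne : f i ≠ f j := fun he =>
      hi (hf (by simp) (by simp [hj]) he ▸ hj)
    simpa [Finsupp.single_apply, hne] using ha j (Finset.mem_insert_of_mem hj)

/-- If `p ≤ a` may be traded for `q` modulo `I`, and `q` shares an edge with `b`, then comparing `a`
with `b` reduces to a comparison in lower degree. -/
lemma exchange {I : Ideal (MvPolynomial G.edgeSet K)} {a b p q : G.edgeSet →₀ ℕ}
    (ih : ∀ a' b' : G.edgeSet →₀ ℕ, a'.degree < a.degree → edgeDeg G a' = edgeDeg G b' →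
      monomial a' (1 : K) - monomial b' 1 ∈ I)
    (hab : edgeDeg G a = edgeDeg G b) (hp : p ≤ a) (hpq : edgeDeg G p = edgeDeg G q)
    (hI : monomial p (1 : K) - monomial q 1 ∈ I) {e : G.edgeSet} (hq : q e ≠ 0) (hb : b e ≠ 0) :
    monomial a (1 : K) - monomial b 1 ∈ I := by
  obtain ⟨a', rfl⟩ := exists_add_of_le hp
  obtain ⟨q', rfl⟩ := exists_add_of_le
    (Finsupp.single_le_iff.mpr (Nat.one_le_iff_ne_zero.mpr hq))
  obtain ⟨b', rfl⟩ := exists_add_of_le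
    (Finsupp.single_le_iff.mpr (Nat.one_le_iff_ne_zero.mpr hb))
  have hd := degree_eq_of_edgeDeg_eq hpq
  have h1 : monomial (a' + q') (1 : K) - monomial b' 1 ∈ I := by
    refine ih _ _ ?_ ?_
    · simp only [map_add, Finsupp.degree_single] at hd ⊢
      omega
    · have := hab
      rw [map_add, hpq] at this
      simp only [map_add, add_assoc] at this ⊢
      rw [add_comm, add_left_cancel this]
  have h2 := I.add_mem (I.mul_mem_left (monomial a' 1) hI)
    (I.mul_mem_left (monomial (Finsupp.single e 1) 1) h1)
  convert h2 using 1
  simp only [mul_sub, monomial_mul, mul_one]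
  rw [add_comm p a', show a' + (Finsupp.single e 1 + q') = Finsupp.single e 1 + (a' + q') by abel]
  ring

end Auxiliary

section Alternating

variable {V S : Type} {G : SimpleGraph V}

/-- A self-map of a set of vertices, moving every vertex to a neighbour along an edge of `a` or of
`b` according to the colour of the vertex. -/
structure AlternatingStep (G : SimpleGraph V) (c : V → Bool) (a b : G.edgeSet →₀ ℕ)
    (ι : S → V) (F : S → S) : Prop where
  injective : Function.Injective ι
  color : ∀ u w, G.Adj u w → c w = !c u
  adj : ∀ s, G.Adj (ι s) (ι (F s))
  left : ∀ s, c (ι s) = false → a ⟨s(ι s, ι (F s)), adj s⟩ ≠ 0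
  right : ∀ s, c (ι s) = true → b ⟨s(ι s, ι (F s)), adj s⟩ ≠ 0
  disjoint : ∀ e, a e ≠ 0 → b e ≠ 0 → False

namespace AlternatingStep

variable {c : V → Bool} {a b : G.edgeSet →₀ ℕ} {ι : S → V} {F : S → S}

/-- The edge along which a vertex is moved. -/
def edge (A : AlternatingStep G c a b ι F) (s : S) : G.edgeSet := ⟨s(ι s, ι (F s)), A.adj s⟩

lemma color_map (A : AlternatingStep G c a b ι F) (s : S) : c (ι (F s)) = !c (ι s) :=
  A.color _ _ (A.adj s)

lemma color_iterate_two_mul (A : AlternatingStep G c a b ι F) (s : S) (k : ℕ) :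
    c (ι (F^[2 * k] s)) = c (ι s) := by
  induction k with
  | zero => rfl
  | succ k ih =>
    rw [mul_add_one, Function.iterate_succ_apply', Function.iterate_succ_apply', A.color_map,
      A.color_map, ih, Bool.not_not]

lemma color_iterate_two_mul_add_one (A : AlternatingStep G c a b ι F) (s : S) (k : ℕ) :
    c (ι (F^[2 * k + 1] s)) = !c (ι s) := by
  rw [Function.iterate_succ_apply', A.color_map, A.color_iterate_two_mul]

lemma edge_inj (A : AlternatingStep G c a b ι F) {s t : S}
    (hc : c (ι s) = c (ι t)) (h : A.edge s = A.edge t) : s = t := by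
  have h : s(ι s, ι (F s)) = s(ι t, ι (F t)) := congrArg Subtype.val h
  rcases Sym2.eq_iff.mp h with ⟨h, -⟩ | ⟨h, -⟩
  · exact A.injective h
  · rw [h, A.color_map] at hc
    simp at hc

lemma edgeEnds_edge (A : AlternatingStep G c a b ι F) (s : S) :
    edgeEnds G (A.edge s) = Finsupp.single (ι s) 1 + Finsupp.single (ι (F s)) 1 :=
  rfl

lemma even_minimalPeriod (A : AlternatingStep G c a b ι F) (x : S) :
    Even (Function.minimalPeriod F x) := by
  rcases Nat.even_or_odd' (Function.minimalPeriod F x) with ⟨k, hk | hk⟩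
  · exact ⟨k, by omega⟩
  · have h := A.color_iterate_two_mul_add_one x k
    rw [← hk, Function.iterate_minimalPeriod] at h
    simp at h

lemma exists_periodic (A : AlternatingStep G c a b ι F) [Finite S] [Nonempty S] :
    ∃ x n, c (ι x) = false ∧ 2 ≤ n ∧ Function.minimalPeriod F x = 2 * n := by
  obtain ⟨s⟩ := ‹Nonempty S›
  obtain ⟨i, j, hij, h⟩ := Finite.exists_ne_map_eq_of_infinite fun i : ℕ => F^[i] s
  wlog hlt : i < j generalizing i j
  · exact this j i hij.symm h.symm (by omega)
  have hy : F^[i] s ∈ Function.periodicPts F := by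
    refine ⟨j - i, by omega, ?_⟩
    change F^[j - i] (F^[i] s) = F^[i] s
    rw [← Function.iterate_add_apply, Nat.sub_add_cancel hlt.le]
    exact h.symm
  obtain ⟨x, hx, hc⟩ : ∃ x ∈ Function.periodicPts F, c (ι x) = false := by
    by_cases hc : c (ι (F^[i] s)) = false
    · exact ⟨_, hy, hc⟩
    · refine ⟨F (F^[i] s), ?_, by simpa [A.color_map] using hc⟩
      obtain ⟨k, hk, hp⟩ := hy
      exact ⟨k, hk, hp.map (Function.Commute.refl F)⟩
  obtain ⟨n, hn⟩ := A.even_minimalPeriod x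
  have hpos := Function.minimalPeriod_pos_of_mem_periodicPts hx
  refine ⟨x, n, hc, ?_, by omega⟩
  by_contra hlt
  have h2 : F (F x) = x := by
    have := Function.iterate_minimalPeriod (f := F) (x := x)
    rwa [show Function.minimalPeriod F x = 2 by omega] at this
  refine A.disjoint _ (A.left x hc) ?_
  have hr := A.right (F x) (by rw [A.color_map, hc]; rfl)
  convert hr using 3
  exact Subtype.ext (Sym2.eq_iff.mpr (Or.inr ⟨congrArg ι h2.symm, rfl⟩))

lemma sum_edge_le (A : AlternatingStep G c a b ι F) {x : S} {n : ℕ} (hx : c (ι x) = false)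
    (hn : 2 * n ≤ Function.minimalPeriod F x) :
    ∑ i ∈ Finset.range n, Finsupp.single (A.edge (F^[2 * i] x)) 1 ≤ a := by
  refine sum_single_le _ _ (fun i hi j hj h => ?_) _ fun i _ => A.left _ ?_
  · have := A.edge_inj (by simp only [A.color_iterate_two_mul]) h
    have hi := Finset.mem_range.mp hi
    have hj := Finset.mem_range.mp hj
    have := Function.iterate_injOn_Iio_minimalPeriod (f := F) (x := x)
      (show 2 * i ∈ Set.Iio _ by simp; omega) (show 2 * j ∈ Set.Iio _ by simp; omega) this
    omega
  · rw [A.color_iterate_two_mul, hx]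

lemma edgeDeg_sum_edge (A : AlternatingStep G c a b ι F) (f : ℕ → S) (n : ℕ) :
    edgeDeg G (∑ i ∈ Finset.range n, Finsupp.single (A.edge (f i)) 1)
      = ∑ i ∈ Finset.range n, (Finsupp.single (ι (f i)) 1 + Finsupp.single (ι (F (f i))) 1) := by
  simp only [map_sum, edgeDeg_single, A.edgeEnds_edge]

lemma edgeDeg_path (A : AlternatingStep G c a b ι F) (x : S) (n : ℕ) :
    edgeDeg G (∑ i ∈ Finset.range n, Finsupp.single (A.edge (F^[2 * i] x)) 1)
        + Finsupp.single (ι (F^[2 * n] x)) 1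
      = Finsupp.single (ι x) 1
        + edgeDeg G (∑ i ∈ Finset.range n, Finsupp.single (A.edge (F^[2 * i + 1] x)) 1) := by
  rw [A.edgeDeg_sum_edge, A.edgeDeg_sum_edge]
  have := sum_even_pairs_add (fun j => Finsupp.single (ι (F^[j] x)) (1 : ℕ)) n
  simpa only [Function.iterate_succ_apply', Function.iterate_zero_apply] using this

lemma sum_edge_odd_ne_zero (A : AlternatingStep G c a b ι F) (x : S) {n : ℕ} (hn : 0 < n) :
    (∑ i ∈ Finset.range n, Finsupp.single (A.edge (F^[2 * i + 1] x)) 1) (A.edge (F x)) ≠ 0 := by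
  rw [← Nat.succ_pred_eq_of_pos hn, Finset.sum_range_succ']
  simp

variable {K : Type} [Field K] {I : Ideal (MvPolynomial G.edgeSet K)}

/-- A chord of an alternating cycle cuts off an alternating path whose edges may be traded, by
induction on the degree. -/
lemma sub_mem_of_chord (A : AlternatingStep G c a b ι F)
    (hab : edgeDeg G a = edgeDeg G b)
    (ih : ∀ a' b' : G.edgeSet →₀ ℕ, a'.degree < a.degree → edgeDeg G a' = edgeDeg G b' →
      monomial a' (1 : K) - monomial b' 1 ∈ I)
    {x : S} {n t : ℕ} (hx : c (ι x) = false) (hn : Function.minimalPeriod F x = 2 * n)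
    (ht : t < 2 * n) (hadj : G.Adj (ι x) (ι (F^[t] x))) (h1 : t ≠ 1) (h2 : t + 1 ≠ 2 * n) :
    monomial a (1 : K) - monomial b 1 ∈ I := by
  have hct := A.color _ _ hadj
  obtain ⟨k, rfl | rfl⟩ := Nat.even_or_odd' t
  · rw [A.color_iterate_two_mul] at hct
    simp at hct
  have hle := A.sum_edge_le (n := k + 1) hx (by omega)
  have hdeg : edgeDeg G (∑ i ∈ Finset.range (k + 1), Finsupp.single (A.edge (F^[2 * i] x)) 1)
      = edgeDeg G (Finsupp.single ⟨s(ι x, ι (F^[2 * k + 1] x)), hadj⟩ 1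
        + ∑ i ∈ Finset.range k, Finsupp.single (A.edge (F^[2 * i + 1] x)) 1) := by
    rw [Finset.sum_range_succ, map_add, map_add, edgeDeg_single, edgeDeg_single, A.edgeEnds_edge,
      edgeEnds_mk (G.mem_edgeSet.mpr hadj), ← add_assoc, A.edgeDeg_path,
      Function.iterate_succ_apply']
    abel
  refine exchange ih hab hle hdeg (ih _ _ ?_ hdeg) (e := A.edge (F x)) ?_
    (A.right _ (by rw [A.color_map, hx]; rfl))
  · have := Finsupp.degree_mono (A.sum_edge_le (n := n) hx hn.ge)
    simp only [map_sum, Finsupp.degree_single, Finset.sum_const, Finset.card_range, smul_eq_mul,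
      mul_one] at this ⊢
    omega
  · have := A.sum_edge_odd_ne_zero x (n := k) (by omega)
    simp only [Finsupp.add_apply]
    omega

lemma sub_mem (A : AlternatingStep G c a b ι F) [Finite S] [Nonempty S]
    (hI : chordlessCycleBinomials K G ⊆ I)
    (hab : edgeDeg G a = edgeDeg G b)
    (ih : ∀ a' b' : G.edgeSet →₀ ℕ, a'.degree < a.degree → edgeDeg G a' = edgeDeg G b' →
      monomial a' (1 : K) - monomial b' 1 ∈ I) :
    monomial a (1 : K) - monomial b 1 ∈ I := by
  obtain ⟨x, n, hx, hn, hper⟩ := A.exists_periodic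
  by_contra hnot
  have : NeZero (2 * n) := ⟨by omega⟩
  have hxp : x ∈ Function.periodicPts F :=
    Function.minimalPeriod_pos_iff_mem_periodicPts.mp (by omega)
  set v : ZMod (2 * n) → V := fun z => ι (F^[z.val] x) with hv
  have hcast (k : ℕ) : v k = ι (F^[k] x) := by
    simp only [hv, ZMod.val_natCast]
    rw [← hper, Function.iterate_mod_minimalPeriod_eq]
  have hcast1 (k : ℕ) : v (k + 1) = ι (F^[k + 1] x) := by
    exact_mod_cast hcast (k + 1)
  have hcast2 (k : ℕ) : v (k + 1 + 1) = ι (F^[k + 1 + 1] x) := by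
    exact_mod_cast hcast (k + 1 + 1)
  have hinj : Function.Injective v := fun y z h => by
    refine ZMod.val_injective _ (Function.iterate_injOn_Iio_minimalPeriod (f := F) (x := x) ?_ ?_
      (A.injective h))
    · simpa [hper] using ZMod.val_lt y
    · simpa [hper] using ZMod.val_lt z
  have hadj (z : ZMod (2 * n)) : G.Adj (v z) (v (z + 1)) := by
    obtain ⟨k, rfl⟩ := ZMod.natCast_zmod_surjective z
    rw [hcast, hcast1, Function.iterate_succ_apply']
    exact A.adj _
  have hchord (y z : ZMod (2 * n)) (h : G.Adj (v y) (v z)) (hc : c (v y) = false) :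
      z = y + 1 ∨ y = z + 1 := by
    obtain ⟨d, rfl⟩ : ∃ d, z = y + d := ⟨z - y, by ring⟩
    have hd : v (y + d) = ι (F^[d.val] (F^[y.val] x)) := by
      rw [← Function.iterate_add_apply, ← hcast]
      simp [add_comm]
    by_contra! hne
    rw [hd] at h
    refine hnot (A.sub_mem_of_chord hab ih hc
      ((Function.minimalPeriod_apply_iterate hxp _).trans hper) (ZMod.val_lt d) h ?_ ?_)
    · intro h1
      refine hne.1 ?_
      rw [← ZMod.natCast_zmod_val d, h1, Nat.cast_one]
    · intro h1
      refine hne.2 ?_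
      have : ((d.val + 1 : ℕ) : ZMod (2 * n)) = 0 := by rw [h1, ZMod.natCast_self]
      rw [Nat.cast_add, ZMod.natCast_zmod_val, Nat.cast_one] at this
      rw [add_assoc, this, add_zero]
  have hmem : cycleBinomial K G n v hadj ∈ I := by
    refine hI ⟨n, hn, v, hinj, hadj, fun y z h => ?_, rfl⟩
    cases hc : c (v y)
    · exact hchord y z h hc
    · exact (hchord z y h.symm (by rw [A.color _ _ h, hc]; rfl)).symm
  have hX (g : ℕ → G.edgeSet) : ∏ i : Fin n, X (R := K) (g i)
      = monomial (∑ i ∈ Finset.range n, Finsupp.single (g i) 1) 1 := by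
    rw [← Finset.prod_range fun i => X (R := K) (g i), monomial_sum_one]
    rfl
  have hbin : cycleBinomial K G n v hadj
      = monomial (∑ i ∈ Finset.range n, Finsupp.single (A.edge (F^[2 * i] x)) 1) 1
        - monomial (∑ i ∈ Finset.range n, Finsupp.single (A.edge (F^[2 * i + 1] x)) 1) 1 := by
    rw [← hX fun i => A.edge (F^[2 * i] x), ← hX fun i => A.edge (F^[2 * i + 1] x), cycleBinomial]
    simp only [hcast, hcast1, hcast2, Function.iterate_succ_apply']
    rfl
  refine hnot (exchange ih hab (A.sum_edge_le hx hper.ge) ?_ (hbin ▸ hmem)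
    (A.sum_edge_odd_ne_zero x (by omega)) (A.right _ (by rw [A.color_map, hx]; rfl)))
  have h := A.edgeDeg_path x n
  rw [← hper, Function.iterate_minimalPeriod, add_comm] at h
  exact add_left_cancel h

end AlternatingStep

end Alternating

lemma monomial_sub_monomial_mem {V K : Type} [Finite V] [Field K] {G : SimpleGraph V}
    {c : V → Bool} (hc : ∀ u w, G.Adj u w → c w = !c u) {I : Ideal (MvPolynomial G.edgeSet K)}
    (hI : chordlessCycleBinomials K G ⊆ I) (a b : G.edgeSet →₀ ℕ)
    (hab : edgeDeg G a = edgeDeg G b) : monomial a (1 : K) - monomial b 1 ∈ I := by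
  induction hN : a.degree using Nat.strong_induction_on generalizing a b with
  | _ N IH =>
  have ih (a' b' : G.edgeSet →₀ ℕ) (hlt : a'.degree < a.degree)
      (h : edgeDeg G a' = edgeDeg G b') : monomial a' (1 : K) - monomial b' 1 ∈ I :=
    IH _ (hN ▸ hlt) a' b' h rfl
  by_cases hdisj : ∀ e, a e ≠ 0 → b e ≠ 0 → False
  · have hstep (s : {v // edgeDeg G a v ≠ 0}) : ∃ (t : {v // edgeDeg G a v ≠ 0})
        (h : G.Adj s.1 t.1), (c s.1 = false → a ⟨s(s.1, t.1), h⟩ ≠ 0) ∧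
          (c s.1 = true → b ⟨s(s.1, t.1), h⟩ ≠ 0) := by
      obtain ⟨s, hs⟩ := s
      cases hcs : c s
      · obtain ⟨t, h, ht⟩ := exists_adj_of_edgeDeg_ne_zero hs
        refine ⟨⟨t, edgeDeg_ne_zero h.symm ?_⟩, h, fun _ => ht, by simp⟩
        convert ht using 3
        exact Subtype.ext Sym2.eq_swap
      · obtain ⟨t, h, ht⟩ := exists_adj_of_edgeDeg_ne_zero (hab ▸ hs)
        refine ⟨⟨t, hab ▸ edgeDeg_ne_zero h.symm ?_⟩, h, by simp, fun _ => ht⟩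
        convert ht using 3
        exact Subtype.ext Sym2.eq_swap
    choose F hF hl hr using hstep
    have A : AlternatingStep G c a b Subtype.val F :=
      ⟨Subtype.val_injective, hc, hF, hl, hr, hdisj⟩
    rcases isEmpty_or_nonempty {v // edgeDeg G a v ≠ 0} with hS | hS
    · have h0 : edgeDeg G a = 0 := by
        ext v
        by_contra hv
        exact hS.false ⟨v, hv⟩
      have ha := degree_edgeDeg a
      have hb := degree_edgeDeg b
      rw [h0, map_zero] at ha
      rw [← hab, h0, map_zero] at hb
      rw [(Finsupp.degree_eq_zero_iff a).mp (by omega),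
        (Finsupp.degree_eq_zero_iff b).mp (by omega), sub_self]
      exact I.zero_mem
    · exact A.sub_mem hI hab ih
  · push Not at hdisj
    obtain ⟨e, ha, hb, -⟩ := hdisj
    exact exchange ih hab (Finsupp.single_le_iff.mpr (Nat.one_le_iff_ne_zero.mpr ha)) rfl
      (by rw [sub_self]; exact I.zero_mem) (e := e) (by simp) hb

lemma toricIdealGraph_le {V K : Type} [Field K] {G : SimpleGraph V}
    {I : Ideal (MvPolynomial G.edgeSet K)}
    (hI : ∀ a b : G.edgeSet →₀ ℕ, edgeDeg G a = edgeDeg G b →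
      monomial a (1 : K) - monomial b 1 ∈ I) : toricIdealGraph K G ≤ I := by
  let r : (V →₀ ℕ) → (G.edgeSet →₀ ℕ) := Function.invFun (edgeDeg G)
  let ψ : MvPolynomial V K →ₗ[K] MvPolynomial G.edgeSet K ⧸ I :=
    (basisMonomials V K).constr K fun d => Ideal.Quotient.mk I (monomial (r d) 1)
  have hψ : ψ ∘ₗ (phiG K G).toLinearMap = (Ideal.Quotient.mkₐ K I).toLinearMap := by
    refine (basisMonomials G.edgeSet K).ext fun a => ?_
    have h1 : ψ (monomial (edgeDeg G a) 1)
        = Ideal.Quotient.mk I (monomial (r (edgeDeg G a)) 1) := by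
      rw [← congrFun (coe_basisMonomials V K)]
      exact Module.Basis.constr_basis _ _ _ _
    simp only [coe_basisMonomials, LinearMap.comp_apply, AlgHom.toLinearMap_apply, phiG_monomial,
      h1, Ideal.Quotient.mkₐ_eq_mk]
    exact Ideal.Quotient.eq.mpr (hI _ _ (Function.invFun_eq ⟨a, rfl⟩))
  intro f hf
  have hf : phiG K G f = 0 := hf
  have h := LinearMap.congr_fun hψ f
  rw [LinearMap.comp_apply, AlgHom.toLinearMap_apply, hf, map_zero] at h
  exact Ideal.Quotient.eq_zero_iff_mem.mp h.symm

/-- For a bipartite graph `G`, the toric ideal `I_G` is generated by the binomials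
arising from the chordless cycles of `G`. -/
theorem stmt5 {V : Type} [Fintype V] [DecidableEq V] (K : Type) [Field K]
    (G : SimpleGraph V) (hbip : G.Colorable 2) :
    Ideal.span (chordlessCycleBinomials K G) = toricIdealGraph K G := by
  obtain ⟨C⟩ := hbip
  have hc (u w : V) (h : G.Adj u w) : decide (C w = 0) = !decide (C u = 0) := by
    have := C.valid h
    grind
  refine le_antisymm (Ideal.span_le.mpr ?_)
    (toricIdealGraph_le (monomial_sub_monomial_mem hc Ideal.subset_span))
  rintro _ ⟨n, -, v, -, h, -, rfl⟩
  exact cycleBinomial_mem n v h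
end

section
/- Let G be a finite simple graph, K a field, and let T_1 and T_2 be distinct perfect matchings of G. Let C_1, …, C_r be the connected components of the symmetric difference T_1 Δ T_2 that contain at least one edge (each such component is an even cycle alternating between T_1 and T_2), and for each i let B_{C_i} = y^{T_1 ∩ C_i} − y^{T_2 ∩ C_i} denote the corresponding cycle binomial. Then, with m_1 = y^{T_1 \ C_1} and m_i = y^{(T_1 \ (C_1 ∪ ⋯ ∪ C_i)) ∪ (T_2 ∩ (C_1 ∪ ⋯ ∪ C_{i−1}))} for 2 ≤ i ≤ r, the binomial arising from (T_1, T_2) decomposes as y^{T_1} − y^{T_2} = m_1 B_{C_1} + m_2 B_{C_2} + ⋯ + m_r B_{C_r}. -/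
open MvPolynomial

/-- A perfect matching of a simple graph, given as a finite set of its edges:
every vertex lies in exactly one edge of the matching. -/
def IsPM {V : Type} (G : SimpleGraph V) (M : Finset G.edgeSet) : Prop :=
  ∀ v : V, ∃! e : G.edgeSet, e ∈ M ∧ v ∈ (e : Sym2 V)

/-- The symmetric difference `T₁ Δ T₂` of two edge sets. -/
def symmDiffEdges {V : Type} [DecidableEq V] (G : SimpleGraph V)
    (T1 T2 : Finset G.edgeSet) : Finset G.edgeSet :=
  (T1 \ T2) ∪ (T2 \ T1)

/-- The graph on the vertices of `G` whose edges are the edges in the symmetric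
difference `T₁ Δ T₂`. -/
def diffGraph {V : Type} [DecidableEq V] (G : SimpleGraph V)
    (T1 T2 : Finset G.edgeSet) : SimpleGraph V :=
  SimpleGraph.fromEdgeSet (((symmDiffEdges G T1 T2).image Subtype.val : Finset (Sym2 V)) : Set (Sym2 V))

/-- Telescoping expansion of a difference of products, exchanging the part of `T₁` inside `C i`
for the part of `T₂` inside `C i`, one index at a time. -/
theorem prod_sub_prod_eq_sum_exchange {α R : Type*} [DecidableEq α] [CommRing R] (f : α → R)
    (T1 T2 : Finset α) {r : ℕ} (C : Fin r → Finset α)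
    (hdisj : ∀ i j e, e ∈ C i → e ∈ C j → i = j)
    (hcover : ∀ e, ¬(e ∈ T1 ↔ e ∈ T2) → ∃ i, e ∈ C i) :
    ∏ e ∈ T1, f e - ∏ e ∈ T2, f e =
      ∑ i : Fin r,
        (∏ e ∈ (T1 \ (Finset.univ.filter fun j : Fin r => j ≤ i).biUnion C) ∪
              (T2 ∩ (Finset.univ.filter fun j : Fin r => j < i).biUnion C), f e) *
          (∏ e ∈ T1 ∩ C i, f e - ∏ e ∈ T2 ∩ C i, f e) := by
  let U : ℕ → Finset α := fun k => (Finset.univ.filter fun j : Fin r => (j : ℕ) < k).biUnion C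
  have mem_U (k : ℕ) (e : α) : e ∈ U k ↔ ∃ j : Fin r, (j : ℕ) < k ∧ e ∈ C j := by simp [U]
  let P : ℕ → R := fun k => ∏ e ∈ (T1 \ U k) ∪ (T2 ∩ U k), f e
  have P_zero : P 0 = ∏ e ∈ T1, f e := by simp [P, U]
  have P_last : P r = ∏ e ∈ T2, f e := by
    refine Finset.prod_congr ?_ fun _ _ => rfl
    ext e
    have := hcover e
    simp only [Finset.mem_union, Finset.mem_sdiff, Finset.mem_inter, mem_U, Fin.is_lt, true_and]
    tauto
  have hle (i : Fin r) : (Finset.univ.filter fun j : Fin r => j ≤ i).biUnion C = U (i + 1) := by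
    simp only [U, Nat.lt_succ_iff, Fin.le_def]
  have hlt (i : Fin r) : (Finset.univ.filter fun j : Fin r => j < i).biUnion C = U i := rfl
  have mem_U_succ (i : Fin r) (e : α) : e ∈ U (i + 1) ↔ e ∈ U i ∨ e ∈ C i := by
    rw [← hle, ← hlt]
    simp only [Finset.mem_biUnion, Finset.mem_filter, Finset.mem_univ, true_and, le_iff_lt_or_eq]
    aesop
  have notMem_C (i : Fin r) (e : α) (he : e ∈ U i) : e ∉ C i := fun hi => by
    obtain ⟨j, hj, hej⟩ := (mem_U _ _).1 he
    exact hj.ne (congrArg Fin.val (hdisj j i e hej hi))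
  have step (i : Fin r) :
      (∏ e ∈ (T1 \ U (i + 1)) ∪ (T2 ∩ U i), f e) *
        (∏ e ∈ T1 ∩ C i, f e - ∏ e ∈ T2 ∩ C i, f e) = P i - P (i + 1) := by
    have hd (T : Finset α) : Disjoint ((T1 \ U (i + 1)) ∪ (T2 ∩ U i)) (T ∩ C i) := by
      rw [Finset.disjoint_left]
      intro e
      have := mem_U_succ i e
      have := notMem_C i e
      clear_value P U
      grind
    rw [mul_sub, ← Finset.prod_union (hd T1), ← Finset.prod_union (hd T2)]
    congr 1 <;> refine Finset.prod_congr ?_ fun _ _ => rfl <;> ext e <;>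
      have := mem_U_succ i e <;> have := notMem_C i e <;>
      clear_value P U <;> grind
  simp only [hle, hlt, step]
  rw [Fin.sum_univ_eq_sum_range (fun k => P k - P (k + 1)), Finset.sum_range_sub', P_zero, P_last]

/-- Decomposition of the binomial `y^{T₁} − y^{T₂}` along the connected components
`C_1, …, C_r` of the symmetric difference `T₁ Δ T₂` that contain at least one edge:
`y^{T₁} − y^{T₂} = Σᵢ mᵢ B_{Cᵢ}` where `B_{Cᵢ} = y^{T₁ ∩ Cᵢ} − y^{T₂ ∩ Cᵢ}`,
`m₁ = y^{T₁ \ C₁}` and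
`mᵢ = y^{(T₁ \ (C₁ ∪ ⋯ ∪ Cᵢ)) ∪ (T₂ ∩ (C₁ ∪ ⋯ ∪ Cᵢ₋₁))}` for `i ≥ 2`. -/
theorem stmt11 {V : Type} [Fintype V] [DecidableEq V] (K : Type) [Field K]
    (G : SimpleGraph V) (T1 T2 : Finset G.edgeSet)
    (h1 : IsPM G T1) (h2 : IsPM G T2) (hne : T1 ≠ T2)
    (r : ℕ) (C : Fin r → Finset G.edgeSet)
    (hinj : Function.Injective C)
    -- each `C i` is the set of edges of `T₁ Δ T₂` lying in some connected component
    (hcomp : ∀ i : Fin r, ∃ W : (diffGraph G T1 T2).ConnectedComponent,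
      ∀ e : G.edgeSet, e ∈ C i ↔ (e ∈ symmDiffEdges G T1 T2 ∧
        ∀ w : V, w ∈ (e : Sym2 V) → (diffGraph G T1 T2).connectedComponentMk w = W))
    -- each `C i` contains at least one edge
    (hnon : ∀ i : Fin r, (C i).Nonempty)
    -- every component containing an edge appears in the list
    (hall : ∀ e ∈ symmDiffEdges G T1 T2, ∃ i : Fin r, e ∈ C i) :
    ((∏ e ∈ T1, X e : MvPolynomial G.edgeSet K)) - (∏ e ∈ T2, X e) =
      ∑ i : Fin r,
        (∏ e ∈ (T1 \ (Finset.univ.filter fun j : Fin r => j ≤ i).biUnion C) ∪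
              (T2 ∩ (Finset.univ.filter fun j : Fin r => j < i).biUnion C), X e) *
          ((∏ e ∈ T1 ∩ C i, X e) - ∏ e ∈ T2 ∩ C i, X e) := by
  refine prod_sub_prod_eq_sum_exchange X T1 T2 C (fun i j e hi hj => hinj ?_) fun e he =>
    hall e ?_
  · obtain ⟨W, hW⟩ := hcomp i
    obtain ⟨W', hW'⟩ := hcomp j
    obtain ⟨v, hv⟩ : ∃ v, v ∈ (e : Sym2 V) := ⟨_, Sym2.out_fst_mem _⟩
    obtain rfl : W = W' := (((hW e).1 hi).2 v hv).symm.trans (((hW' e).1 hj).2 v hv)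
    ext e'
    rw [hW, hW']
  · simp only [symmDiffEdges, Finset.mem_union, Finset.mem_sdiff]
    tauto
end

section
/- Let G be a finite simple graph, K a field, and let e_1, e_2, e_3, e_4 be edges of G such that the binomial y_{e_1} y_{e_2} − y_{e_3} y_{e_4} is a nonzero element of the toric ideal I_G. Then e_1 and e_2 are vertex-disjoint, e_3 and e_4 are vertex-disjoint, the four edges cover the same set of four vertices, and e_1, e_3, e_2, e_4 are the consecutive edges of a 4-cycle of G; that is, every nonzero quadratic binomial in I_G corresponds to a 4-cycle of G. -/
open MvPolynomial

/-- Two products of four variables agree only if the underlying multisets of indices do. -/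
lemma multiset_eq_of_X_mul_eq {σ R : Type*} [CommSemiring R] [Nontrivial R]
    {a b c d p q r s : σ}
    (h : (X a * X b * (X c * X d) : MvPolynomial σ R) = X p * X q * (X r * X s)) :
    ({a, b, c, d} : Multiset σ) = {p, q, r, s} := by
  classical
  have key : ∀ a b c d : σ, (X a * X b * (X c * X d) : MvPolynomial σ R) =
      monomial (Multiset.toFinsupp {a, b, c, d}) 1 := by
    intro a b c d
    simp only [X, monomial_mul, mul_one, Multiset.insert_eq_cons, ← Multiset.singleton_add,
      map_add, Multiset.toFinsupp_singleton, add_assoc]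
  rw [key, key] at h
  exact Multiset.toFinsupp.injective (monomial_left_injective one_ne_zero h)

/-- If two different pairs of non-loop edges have the same multiset of endpoints, then the
endpoints are distinct and the four edges form an alternating 4-cycle. -/
lemma exists_alternating_fourCycle {V : Type*} {a b c d p q r s : V}
    (hab : a ≠ b) (hcd : c ≠ d) (hpq : p ≠ q) (hrs : r ≠ s)
    (h : ({a, b, c, d} : Multiset V) = {p, q, r, s})
    (h1 : ¬ (s(a, b) = s(p, q) ∧ s(c, d) = s(r, s)))
    (h2 : ¬ (s(a, b) = s(r, s) ∧ s(c, d) = s(p, q))) :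
    ∃ t u v w : V, t ≠ u ∧ t ≠ v ∧ t ≠ w ∧ u ≠ v ∧ u ≠ w ∧ v ≠ w ∧
      s(a, b) = s(t, u) ∧ s(p, q) = s(u, v) ∧ s(c, d) = s(v, w) ∧ s(r, s) = s(w, t) := by
  have hp : p = a ∨ p = b ∨ p = c ∨ p = d := by
    have : p ∈ ({a, b, c, d} : Multiset V) := h ▸ by simp
    simpa using this
  have hq : q = a ∨ q = b ∨ q = c ∨ q = d := by
    have : q ∈ ({a, b, c, d} : Multiset V) := h ▸ by simp
    simpa using this
  classical
  have hcount : ∀ x : V, _ := fun x => congrArg (Multiset.count x) h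
  simp only [Multiset.insert_eq_cons, Multiset.count_cons, Multiset.count_singleton] at hcount
  have ha := hcount a
  have hb := hcount b
  have hc := hcount c
  have hd := hcount d
  have hs := hcount s
  clear hcount h
  have hex : ((p = a ∨ p = b) ∧ (q = c ∨ q = d)) ∨ ((p = c ∨ p = d) ∧ (q = a ∨ q = b)) := by
    simp only [Sym2.eq_iff] at h1 h2
    grind
  simp only [Sym2.eq_iff] at h1 h2 ⊢
  rcases hex with ⟨rfl | rfl, rfl | rfl⟩ | ⟨rfl | rfl, rfl | rfl⟩
  · exact ⟨b, p, q, d, by grind⟩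
  · exact ⟨b, p, q, c, by grind⟩
  · exact ⟨a, p, q, d, by grind⟩
  · exact ⟨a, p, q, c, by grind⟩
  · exact ⟨b, q, p, d, by grind⟩
  · exact ⟨a, q, p, d, by grind⟩
  · exact ⟨b, q, p, c, by grind⟩
  · exact ⟨a, q, p, c, by grind⟩

/-- Every nonzero quadratic binomial `y_{e₁} y_{e₂} − y_{e₃} y_{e₄}` in the toric
ideal `I_G` corresponds to a 4-cycle of `G`: `e₁, e₂` are vertex-disjoint, so are
`e₃, e₄`, all four edges cover the same set of four vertices, and
`e₁, e₃, e₂, e₄` are the consecutive edges of a 4-cycle of `G`. -/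
theorem stmt14 {V : Type} [Fintype V] [DecidableEq V] (K : Type) [Field K]
    (G : SimpleGraph V) (e1 e2 e3 e4 : G.edgeSet)
    (hmem : (X e1 * X e2 - X e3 * X e4 : MvPolynomial G.edgeSet K)
      ∈ toricIdealGraph K G)
    (hnz : (X e1 * X e2 - X e3 * X e4 : MvPolynomial G.edgeSet K) ≠ 0) :
    (∀ w : V, w ∈ (e1 : Sym2 V) → w ∉ (e2 : Sym2 V)) ∧
    (∀ w : V, w ∈ (e3 : Sym2 V) → w ∉ (e4 : Sym2 V)) ∧
    ({w : V | w ∈ (e1 : Sym2 V) ∨ w ∈ (e2 : Sym2 V)} =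
      {w : V | w ∈ (e3 : Sym2 V) ∨ w ∈ (e4 : Sym2 V)}) ∧
    ({w : V | w ∈ (e1 : Sym2 V) ∨ w ∈ (e2 : Sym2 V)} : Set V).ncard = 4 ∧
    ∃ a b c d : V, a ≠ c ∧ b ≠ d ∧
      (e1 : Sym2 V) = s(a, b) ∧ (e3 : Sym2 V) = s(b, c) ∧
      (e2 : Sym2 V) = s(c, d) ∧ (e4 : Sym2 V) = s(d, a) := by
  obtain ⟨⟨a, b⟩, hab⟩ := e1
  obtain ⟨⟨c, d⟩, hcd⟩ := e2
  obtain ⟨⟨p, q⟩, hpq⟩ := e3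
  obtain ⟨⟨r, s⟩, hrs⟩ := e4
  have hX : (X a * X b * (X c * X d) : MvPolynomial V K) = X p * X q * (X r * X s) := by
    have h : phiG K G _ = 0 := hmem
    simp only [phiG, map_sub, map_mul, aeval_X] at h
    exact sub_eq_zero.mp h
  have hne : ∀ {x y : V}, s(x, y) ∈ G.edgeSet → x ≠ y := fun h => G.ne_of_adj h
  obtain ⟨t, u, v, w, htu, htv, htw, huv, huw, hvw, h1, h3, h2, h4⟩ :=
    exists_alternating_fourCycle (hne hab) (hne hcd) (hne hpq) (hne hrs)
      (multiset_eq_of_X_mul_eq hX)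
      (fun h => hnz <| by
        rw [sub_eq_zero]
        exact congrArg₂ (fun e f => X e * X f) (Subtype.ext h.1) (Subtype.ext h.2))
      (fun h => hnz <| by
        rw [sub_eq_zero]
        exact (congrArg₂ (fun e f => X e * X f) (Subtype.ext h.1) (Subtype.ext h.2)).trans
          (mul_comm _ _))
  change (∀ x, x ∈ s(a, b) → x ∉ s(c, d)) ∧ (∀ x, x ∈ s(p, q) → x ∉ s(r, s)) ∧
    {x | x ∈ s(a, b) ∨ x ∈ s(c, d)} = {x | x ∈ s(p, q) ∨ x ∈ s(r, s)} ∧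
    {x | x ∈ s(a, b) ∨ x ∈ s(c, d)}.ncard = 4 ∧ ∃ t u v w : V, t ≠ v ∧ u ≠ w ∧
      s(a, b) = s(t, u) ∧ s(p, q) = s(u, v) ∧ s(c, d) = s(v, w) ∧ s(r, s) = s(w, t)
  rw [h1, h2, h3, h4]
  simp only [Sym2.mem_iff]
  refine ⟨by grind, by grind, by grind, ?_, t, u, v, w, htv, huw, rfl, rfl, rfl, rfl⟩
  have hset : {x | (x = t ∨ x = u) ∨ x = v ∨ x = w} = (({t, u, v, w} : Finset V) : Set V) := by
    ext x
    simp [or_assoc]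
  rw [hset, Set.ncard_coe_finset]
  simp [*]
end
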